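/- The category PCont of propositional containers is cartesian closed (i.e., every propositional container is exponentiable with respect to the binary products ×ᵖ) if and only if the law of excluded middle holds, i.e., ∀ p : Prop, p ∨ ¬ p. -/

import Mathlib

/-- A propositional container: a type of shapes with a `Prop`-valued family of positions. -/
structure PCtnr : Type 1 where
  A : Type
  P : A → Prop

/-- A morphism of propositional containers: a function on shapes whose graph reverses
the positions. -/
structure PHom (X Y : PCtnr) : Type where
  toFun : X.A → Y.A
  prop : ∀ a : X.A, Y.P (toFun a) → X.P a

/-- The identity morphism of propositional containers. -/
def PHom.id (X : PCtnr) : PHom X X :=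
  ⟨fun a => a, fun _ p => p⟩

/-- Composition of morphisms of propositional containers. -/
def PHom.comp {X Y Z : PCtnr} (g : PHom Y Z) (f : PHom X Y) : PHom X Z :=
  ⟨fun a => g.toFun (f.toFun a), fun a r => f.prop a (g.prop (f.toFun a) r)⟩

/-- The binary product of propositional containers. -/
def pprod (X Y : PCtnr) : PCtnr :=
  ⟨X.A × Y.A, fun z => X.P z.1 ∨ Y.P z.2⟩

/-- The first product projection. -/
def pfst (X Y : PCtnr) : PHom (pprod X Y) X :=
  ⟨Prod.fst, fun _ h => Or.inl h⟩

/-- The second product projection. -/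
def psnd (X Y : PCtnr) : PHom (pprod X Y) Y :=
  ⟨Prod.snd, fun _ h => Or.inr h⟩

/-- Pairing of morphisms into a binary product. -/
def ppair {W X Y : PCtnr} (f : PHom W X) (g : PHom W Y) : PHom W (pprod X Y) :=
  ⟨fun w => (f.toFun w, g.toFun w), fun w h => h.elim (f.prop w) (g.prop w)⟩

/-- The functorial action of the binary product on morphisms. -/
def pprodMap {X X' Y Y' : PCtnr} (f : PHom X X') (g : PHom Y Y') :
    PHom (pprod X Y) (pprod X' Y') :=
  ⟨Prod.map f.toFun g.toFun, fun z h => h.imp (f.prop z.1) (g.prop z.2)⟩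

/-- A propositional container `X` is exponentiable when for every `Y` there is an
exponential object `E` with an evaluation morphism satisfying the universal property
of exponentials with respect to the binary products `×ᵖ`. -/
def Exponentiable (X : PCtnr) : Prop :=
  ∀ Y : PCtnr, ∃ (E : PCtnr) (ev : PHom (pprod E X) Y),
    ∀ (C : PCtnr) (f : PHom (pprod C X) Y),
      ∃! g : PHom C E, ev.comp (pprodMap g (PHom.id X)) = f

theorem PHom.ext_toFun {X Y : PCtnr} : ∀ {f g : PHom X Y}, f.toFun = g.toFun → f = g
  | ⟨_, _⟩, ⟨_, _⟩, rfl => rfl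

/-- A container with decidable positions is exponentiable: the exponential `Y ^ X` has all
functions as shapes, with a position at `h` when some `a` has `Y.P (h a)` but not `X.P a`. -/
theorem Exponentiable.of_em {X : PCtnr} (hX : ∀ a, X.P a ∨ ¬ X.P a) : Exponentiable X := by
  intro Y
  refine ⟨⟨X.A → Y.A, fun h => ∃ a, Y.P (h a) ∧ ¬ X.P a⟩,
    ⟨fun z => z.1 z.2, fun z hz => (hX z.2).elim Or.inr fun hn => Or.inl ⟨z.2, hz, hn⟩⟩, ?_⟩
  intro C f
  refine ⟨⟨fun c a => f.toFun (c, a), ?_⟩, rfl, ?_⟩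
  · rintro c ⟨a, hQ, hP⟩
    exact (f.prop (c, a) hQ).resolve_right hP
  · rintro g rfl
    rfl

/-- Exponentiability of the one-shape container with positions `p` decides `p`; this
direction uses no classical axiom. -/
theorem Exponentiable.em {p : Prop} (h : Exponentiable ⟨Unit, fun _ => p⟩) : p ∨ ¬ p := by
  obtain ⟨E, ev, hE⟩ := h ⟨Unit, fun _ => True⟩
  obtain ⟨g, -, hg⟩ := hE ⟨Unit, fun _ => True⟩ ⟨fun _ => (), fun _ _ => Or.inl trivial⟩
  -- `g` picks the only shape of `E`, since every shape is a map out of `⟨Unit, True⟩`.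
  have shape_unique (e : E.A) : e = g.toFun () :=
    congrArg (fun k => k.toFun ()) (hg ⟨fun _ => e, fun _ _ => trivial⟩ (PHom.ext_toFun rfl))
  refine (ev.prop (g.toFun (), ()) trivial).symm.imp id fun hV hp => ?_
  obtain ⟨k, -, -⟩ := hE ⟨Unit, fun _ => False⟩ ⟨fun _ => (), fun _ _ => Or.inr hp⟩
  exact k.prop () (Eq.mpr (congrArg E.P (shape_unique (k.toFun ()))) hV)

/-- The category of propositional containers is cartesian closed if and only if the law
of excluded middle holds. -/
theorem PCtnr_cartesianClosed_iff_em :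
    (∀ X : PCtnr, Exponentiable X) ↔ (∀ p : Prop, p ∨ ¬ p) := by
  exact ⟨fun h p => (h _).em, fun em _ => .of_em fun _ => em _⟩
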